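/- arXiv:1811.05086 — 2 statements merged into one kernel-verified Lean document; each statement's English description precedes it below -/
import Mathlib

section
/- Let c ∈ {0, N} and let [x_k] be a ZMNG CM_c sequence. Then [x_k] is governed by a CM_c model: there exist d×d matrices G_{k,k−1}, G_{k,c} for k ∈ [1,N] \ {c} (and G_{0,N} if c = N) and a zero-mean white Gaussian sequence [e_k]_{k=0}^N with nonsingular (positive definite) covariances G_k = Cov(e_k) such that x_k = G_{k,k−1} x_{k−1} + G_{k,c} x_c + e_k for all k ∈ [1,N] \ {c}, with x_0 = e_0 when c = 0, and x_N = e_N and x_0 = G_{0,N} x_N + e_0 when c = N. -/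
open MeasureTheory ProbabilityTheory

variable {Ω : Type*}

/-- The σ-field generated by the random variables `x k`, `k ∈ S`. -/
noncomputable def sigmaOf [MeasurableSpace Ω] {d : ℕ} (x : ℕ → Ω → (Fin d → ℝ)) (S : Set ℕ) :
    MeasurableSpace Ω :=
  ⨆ k ∈ S, MeasurableSpace.comap (x k) inferInstance

lemma sigmaOf_le [m : MeasurableSpace Ω] {d : ℕ} {x : ℕ → Ω → (Fin d → ℝ)}
    (hx : ∀ k, Measurable (x k)) (S : Set ℕ) : sigmaOf x S ≤ m :=
  iSup_le fun k => iSup_le fun _ => (hx k).comap_le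

/-- `[x_k]` is `CM_c` over `[0,N]` (`CM_F` for `c = 0`, `CM_L` for `c = N`): for every
`j ∈ [0,N]`, the σ-fields generated by `{x_k : k ∈ [j+1,N]} \ {x_c}` and by
`{x_k : k ∈ [0,j-1]} \ {x_c}` are conditionally independent given `σ(x_j, x_c)`. -/
def IsCM [MeasurableSpace Ω] [StandardBorelSpace Ω] {d : ℕ} (N c : ℕ)
    (P : Measure Ω) [IsFiniteMeasure P]
    (x : ℕ → Ω → (Fin d → ℝ)) (hx : ∀ k, Measurable (x k)) : Prop :=
  ∀ j ≤ N, CondIndep (sigmaOf x {j, c})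
    (sigmaOf x {k | j < k ∧ k ≤ N ∧ k ≠ c})
    (sigmaOf x {k | k < j ∧ k ≠ c})
    (sigmaOf_le hx _) P

/-- A random vector is (jointly) Gaussian iff every linear functional of it has a
(possibly degenerate) one-dimensional Gaussian distribution (Cramér–Wold). -/
def IsGaussianVec {ι : Type*} [Fintype ι] [MeasurableSpace Ω]
    (X : Ω → (ι → ℝ)) (P : Measure Ω) : Prop :=
  ∀ a : ι → ℝ, ∃ (mu : ℝ) (v : NNReal),
    Measure.map (fun ω => ∑ i, a i * X ω i) P = gaussianReal mu v

/-- The stacked vector `(x_0', …, x_N')' ∈ ℝ^{(N+1)d}` of the sequence. -/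
def stacked {d : ℕ} (N : ℕ) [MeasurableSpace Ω] (x : ℕ → Ω → (Fin d → ℝ)) (ω : Ω) :
    Fin (N + 1) × Fin d → ℝ :=
  fun p => x p.1 ω p.2

/-- Zero-mean nonsingular Gaussian (ZMNG) sequence: the stacked vector is Gaussian with
zero mean and positive definite covariance matrix. -/
def IsZMNG {d : ℕ} (N : ℕ) [MeasurableSpace Ω] (P : Measure Ω)
    (x : ℕ → Ω → (Fin d → ℝ)) : Prop :=
  IsGaussianVec (stacked N x) P ∧
  (∀ k ≤ N, ∀ a, ∫ ω, x k ω a ∂P = 0) ∧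
  (Matrix.of fun p q : Fin (N + 1) × Fin d =>
    ∫ ω, x p.1 ω p.2 * x q.1 ω q.2 ∂P).PosDef

/-- The sequence `[x_k]` is governed by a `CM_c` model with parameters `A k = G_{k,k-1}`,
`B k = G_{k,c}`, `G0N = G_{0,N}`, noise `[e_k]` and noise covariances `G k`. -/
def GovernedBy {d : ℕ} (N c : ℕ) [MeasurableSpace Ω] (P : Measure Ω)
    (x : ℕ → Ω → (Fin d → ℝ))
    (A B : ℕ → Matrix (Fin d) (Fin d) ℝ) (G0N : Matrix (Fin d) (Fin d) ℝ)
    (e : ℕ → Ω → (Fin d → ℝ)) (G : ℕ → Matrix (Fin d) (Fin d) ℝ) : Prop :=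
  -- the noise `[e_k]` is jointly Gaussian,
  IsGaussianVec (stacked N e) P ∧
  -- zero-mean,
  (∀ k ≤ N, ∀ a, ∫ ω, e k ω a ∂P = 0) ∧
  -- white (pairwise uncorrelated),
  (∀ k ≤ N, ∀ j ≤ N, k ≠ j → ∀ a b, ∫ ω, e k ω a * e j ω b ∂P = 0) ∧
  -- with positive definite covariances `Cov(e_k) = G k`,
  (∀ k ≤ N, (∀ a b, ∫ ω, e k ω a * e k ω b ∂P = G k a b) ∧ (G k).PosDef) ∧
  -- dynamics: `x_k = G_{k,k-1} x_{k-1} + G_{k,c} x_c + e_k` for `k ∈ [1,N] \ {c}`,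
  (∀ k, 1 ≤ k → k ≤ N → k ≠ c → ∀ ω,
    x k ω = (A k).mulVec (x (k - 1) ω) + (B k).mulVec (x c ω) + e k ω) ∧
  -- boundary conditions
  (c = 0 → x 0 = e 0) ∧
  (c = N → x N = e N ∧ ∀ ω, x 0 ω = G0N.mulVec (x N ω) + e 0 ω)

section

variable {mΩ : MeasurableSpace Ω} {P : Measure Ω}

lemma integral_mul_eq_zero_of_forall_setIntegral_eq_zero [IsFiniteMeasure P]
    {m : MeasurableSpace Ω} (hm : m ≤ mΩ) {f u : Ω → ℝ} (hf : StronglyMeasurable[m] f)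
    (hf2 : MemLp f 2 P) (hu : MemLp u 2 P)
    (h : ∀ s, MeasurableSet[m] s → ∫ ω in s, u ω ∂P = 0) : ∫ ω, f ω * u ω ∂P = 0 := by
  have hui : Integrable u P := hu.integrable one_le_two
  have h0 : (0 : Ω → ℝ) =ᵐ[P] P[u|m] :=
    ae_eq_condExp_of_forall_setIntegral_eq hm hui (fun s _ _ => integrableOn_zero)
      (fun s hs _ => by simp [h s hs]) stronglyMeasurable_zero.aestronglyMeasurable
  have h1 := condExp_mul_of_stronglyMeasurable_left hf (hf2.integrable_mul hu) hui
  calc ∫ ω, f ω * u ω ∂P = ∫ ω, P[f * u|m] ω ∂P := (integral_condExp hm).symm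
    _ = 0 := by
      refine integral_eq_zero_of_ae ?_
      filter_upwards [h0, h1] with ω h0 h1
      simp [h1, ← h0]

lemma integral_mul_sub_of_memLp {f g h : Ω → ℝ} (hf : MemLp f 2 P) (hg : MemLp g 2 P)
    (hh : MemLp h 2 P) :
    ∫ ω, f ω * (g - h) ω ∂P = ∫ ω, f ω * g ω ∂P - ∫ ω, f ω * h ω ∂P := by
  simp only [Pi.sub_apply, mul_sub]
  exact integral_sub (hf.integrable_mul hg) (hf.integrable_mul hh)

lemma integral_mul_condExp_eq [IsFiniteMeasure P]
    {m : MeasurableSpace Ω} (hm : m ≤ mΩ) {f g : Ω → ℝ} (hf : MemLp f 2 P) (hg : MemLp g 2 P) :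
    ∫ ω, f ω * P[g|m] ω ∂P = ∫ ω, P[f|m] ω * P[g|m] ω ∂P := by
  have h1 := condExp_mul_of_stronglyMeasurable_right (m := m) (μ := P) (f := f) (g := P[g|m])
    stronglyMeasurable_condExp (hf.integrable_mul (hg.condExp one_le_two))
      (hf.integrable one_le_two)
  calc ∫ ω, f ω * P[g|m] ω ∂P = ∫ ω, P[f * P[g|m]|m] ω ∂P := (integral_condExp hm).symm
    _ = ∫ ω, P[f|m] ω * P[g|m] ω ∂P := integral_congr_ae h1

lemma setIntegral_eq_integral_mul_indicator {s : Set Ω} (hs : MeasurableSet s) (f : Ω → ℝ) :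
    ∫ ω in s, f ω ∂P = ∫ ω, f ω * s.indicator (fun _ => (1 : ℝ)) ω ∂P := by
  rw [← integral_indicator hs]
  congr 1 with ω
  by_cases h : ω ∈ s <;> simp [h]

/-- Under conditional independence, covariances factor through conditional expectations. -/
lemma integral_mul_eq_of_condIndep [StandardBorelSpace Ω] [IsFiniteMeasure P]
    {m' m₁ m₂ : MeasurableSpace Ω} (hm' : m' ≤ mΩ) (hm₁ : m₁ ≤ mΩ) (hm₂ : m₂ ≤ mΩ)
    (h : CondIndep m' m₁ m₂ hm' P) {f y : Ω → ℝ} (hf : StronglyMeasurable[m₁] f)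
    (hy : StronglyMeasurable[m₂] y) (hf2 : MemLp f 2 P) (hy2 : MemLp y 2 P) :
    ∫ ω, f ω * y ω ∂P = ∫ ω, P[f|m'] ω * y ω ∂P := by
  have hind : ∀ s, MeasurableSet[mΩ] s → MemLp (s.indicator (fun _ => (1 : ℝ))) 2 P :=
    fun s hs => memLp_indicator_const 2 hs (1 : ℝ) (Or.inr (measure_ne_top P s))
  have hsets := (condIndep_iff m' m₁ m₂ hm' hm₁ hm₂ P).1 h
  have hfB : ∀ B, MeasurableSet[m₂] B →
      ∫ ω, f ω * (B.indicator (fun _ => (1 : ℝ)) - P⟦B|m'⟧) ω ∂P = 0 := by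
    intro B hB
    have hB' := hm₂ B hB
    refine integral_mul_eq_zero_of_forall_setIntegral_eq_zero hm₁ hf hf2
      ((hind B hB').sub ((hind B hB').condExp one_le_two)) fun A hA => ?_
    have hA' := hm₁ A hA
    have h1 : ∫ ω in A, (P⟦B|m'⟧) ω ∂P = ∫ ω in A, B.indicator (fun _ => (1 : ℝ)) ω ∂P := by
      rw [setIntegral_eq_integral_mul_indicator hA']
      simp_rw [mul_comm _ (A.indicator _ _)]
      rw [integral_mul_condExp_eq hm' (hind A hA') (hind B hB')]
      refine (integral_congr_ae (hsets A B hA hB).symm).trans ?_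
      rw [integral_condExp hm', ← integral_indicator hA']
      congr 1 with ω
      rw [Set.indicator_indicator]
    simp only [Pi.sub_apply]
    rw [integral_sub ((hind B hB').integrable one_le_two).integrableOn
      integrable_condExp.integrableOn, h1, sub_self]
  have hfy : ∫ ω, y ω * (f - P[f|m']) ω ∂P = 0 := by
    refine integral_mul_eq_zero_of_forall_setIntegral_eq_zero hm₂ hy hy2
      (hf2.sub (hf2.condExp one_le_two))
      fun B hB => ?_
    have hB' := hm₂ B hB
    have h2 := hfB B hB
    rw [integral_mul_sub_of_memLp hf2 (hind B hB') ((hind B hB').condExp one_le_two),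
      integral_mul_condExp_eq hm' hf2 (hind B hB'), ← setIntegral_eq_integral_mul_indicator hB']
      at h2
    simp only [Pi.sub_apply]
    rw [integral_sub (hf2.integrable one_le_two).integrableOn integrable_condExp.integrableOn,
      setIntegral_eq_integral_mul_indicator hB' (P[f|m'])]
    simp_rw [mul_comm (P[f|m'] _)] at h2 ⊢
    rwa [integral_mul_condExp_eq hm' (hind B hB') hf2]
  rw [integral_mul_sub_of_memLp hy2 hf2 (hf2.condExp one_le_two), sub_eq_zero] at hfy
  simpa only [mul_comm (y _)] using hfy

/-- If the residual `f - g` of the approximation of `f` by an `m'`-measurable `g` is centered and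
independent of `m'`, then it is uncorrelated with whatever is conditionally independent of `f`
given `m'`. -/
lemma integral_sub_mul_eq_zero_of_condIndep [StandardBorelSpace Ω] [IsProbabilityMeasure P]
    {m' m₁ m₂ : MeasurableSpace Ω} (hm' : m' ≤ mΩ) (hm₁ : m₁ ≤ mΩ) (hm₂ : m₂ ≤ mΩ)
    (h : CondIndep m' m₁ m₂ hm' P) {f g y : Ω → ℝ} (hf : StronglyMeasurable[m₁] f)
    (hg : StronglyMeasurable[m'] g)
    (hy : StronglyMeasurable[m₂] y) (hf2 : MemLp f 2 P) (hg2 : MemLp g 2 P) (hy2 : MemLp y 2 P)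
    (hind : Indep (MeasurableSpace.comap (f - g) inferInstance) m' P)
    (hmean : ∫ ω, (f - g) ω ∂P = 0) :
    ∫ ω, (f ω - g ω) * y ω ∂P = 0 := by
  have hfi := hf2.integrable one_le_two
  have hgi := hg2.integrable one_le_two
  have h0 : P[f - g|m'] =ᵐ[P] fun _ => P[f - g] :=
    condExp_indep_eq ((hf.mono hm₁).sub (hg.mono hm')).measurable.comap_le hm'
      (comap_measurable (f - g)).stronglyMeasurable hind
  have h1 : P[f|m'] =ᵐ[P] g := by
    have h2 := condExp_sub hfi hgi m'
    rw [condExp_of_stronglyMeasurable hm' hg hgi] at h2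
    filter_upwards [h0, h2] with ω h0 h2
    rw [h0, hmean, Pi.sub_apply] at h2
    linarith
  have h2 := integral_mul_sub_of_memLp hy2 hf2 hg2
  simp only [mul_comm (y _), Pi.sub_apply] at h2
  rw [h2, integral_mul_eq_of_condIndep hm' hm₁ hm₂ h hf hy hf2 hy2, sub_eq_zero]
  refine integral_congr_ae ?_
  filter_upwards [h1] with ω h1
  rw [h1]

lemma exists_linear_residual_orthogonal {τ : Type*} [Fintype τ] (Z : τ → Ω → ℝ)
    (hZ : ∀ t, MemLp (Z t) 2 P) {y : Ω → ℝ} (hy : MemLp y 2 P) :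
    ∃ w : τ → ℝ, ∀ s, ∫ ω, (y ω - ∑ t, w t * Z t ω) * Z s ω ∂P = 0 := by
  let V := Submodule.span ℝ (Set.range fun t => (hZ t).toLp (Z t))
  have : FiniteDimensional ℝ V := FiniteDimensional.span_of_finite ℝ (Set.finite_range _)
  obtain ⟨w, hw⟩ := (Submodule.mem_span_range_iff_exists_fun ℝ).1
    (V.starProjection_apply_mem (hy.toLp y))
  refine ⟨w, fun s => ?_⟩
  have h1 := V.sub_starProjection_mem_orthogonal (hy.toLp y)
  rw [← hw] at h1
  have h2 := (V.mem_orthogonal _).1 h1 _ (Submodule.subset_span ⟨s, rfl⟩)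
  rw [L2.inner_def] at h2
  rw [← h2]
  refine integral_congr_ae ?_
  have h3 : ∀ᵐ ω ∂P, ∀ t, (hZ t).toLp (Z t) ω = Z t ω :=
    ae_all_iff.2 fun t => (hZ t).coeFn_toLp
  have h4 : ∀ᵐ ω ∂P, ∀ t, (w t • (hZ t).toLp (Z t) : Lp ℝ 2 P) ω = w t * (hZ t).toLp (Z t) ω :=
    ae_all_iff.2 fun t => Lp.coeFn_smul _ _
  have h5 := Lp.coeFn_sub (hy.toLp y) (∑ t, w t • (hZ t).toLp (Z t))
  have h6 := Lp.coeFn_finsetSum Finset.univ fun t => w t • (hZ t).toLp (Z t)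
  filter_upwards [h3, h4, h5, h6, hy.coeFn_toLp] with ω h3 h4 h5 h6 h7
  rw [h5, Pi.sub_apply, h6, h7, Finset.sum_apply, h3]
  simp_rw [h4, h3]
  simp

lemma IsGaussianVec.hasGaussianLaw {ι : Type*} [Fintype ι] {X : Ω → ι → ℝ}
    (h : IsGaussianVec X P) (hX : Measurable X) : HasGaussianLaw X P where
  isGaussian_map := by
    classical
    refine isGaussian_of_map_eq_gaussianReal fun L => ?_
    obtain ⟨mu, v, hv⟩ := h fun i => L (Pi.single i 1)
    refine ⟨mu, v, ?_⟩
    rw [Measure.map_map L.measurable hX, ← hv]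
    congr 1 with ω
    conv_lhs => rw [Function.comp_apply, ← Finset.univ_sum_single (X ω), map_sum]
    refine Finset.sum_congr rfl fun i _ => ?_
    have : Pi.single i (X ω i) = X ω i • (Pi.single i 1 : ι → ℝ) := by
      rw [← Pi.single_smul]; simp
    rw [this, map_smul, smul_eq_mul, mul_comm]

lemma ProbabilityTheory.HasGaussianLaw.isGaussianVec_mulVec {ι κ : Type*} [Fintype ι] [Fintype κ]
    {X : Ω → ι → ℝ}
    (h : HasGaussianLaw X P) (M : Matrix κ ι ℝ) : IsGaussianVec (fun ω => M.mulVec (X ω)) P :=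
  fun a => ⟨_, _, (h.map ((LinearMap.toContinuousLinearMap
    ((dotProductBilin ℝ ℝ a).comp (Matrix.mulVecLin M))))).map_eq_gaussianReal⟩

/-- A linear form in a centered Gaussian vector that is uncorrelated with some coordinates is
independent of them. -/
lemma ProbabilityTheory.HasGaussianLaw.indepFun_of_uncorrelated {ι τ : Type*} [Fintype ι]
    [Fintype τ]
    {X : Ω → ι → ℝ} (h : HasGaussianLaw X P) (hmean : ∀ i, ∫ ω, X ω i ∂P = 0) (w : ι → ℝ)
    (π : τ → ι) (horth : ∀ t, ∫ ω, (w ⬝ᵥ X ω) * X ω (π t) ∂P = 0) :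
    IndepFun (fun ω => w ⬝ᵥ X ω) (fun ω t => X ω (π t)) P := by
  have := h.isProbabilityMeasure
  have hj : HasGaussianLaw (fun ω => (fun _ : Unit => w ⬝ᵥ X ω, fun t => X ω (π t))) P :=
    h.map (LinearMap.toContinuousLinearMap
      ((LinearMap.pi fun _ : Unit => dotProductBilin ℝ ℝ w).prod
        (LinearMap.funLeft ℝ ℝ π)))
  have hw : HasGaussianLaw (fun ω => w ⬝ᵥ X ω) P :=
    h.map (LinearMap.toContinuousLinearMap (dotProductBilin ℝ ℝ w))
  have hi := HasGaussianLaw.indepFun_of_covariance_eval (X := fun _ : Unit => fun ω => w ⬝ᵥ X ω)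
    (Y := fun t ω => X ω (π t)) hj fun _ t => by
      rw [covariance_eq_sub hw.memLp_two (h.eval (π t)).memLp_two, hmean, mul_zero, sub_zero]
      exact horth t
  exact hi.comp (measurable_pi_apply ()) measurable_id

end

section

variable {d : ℕ}

lemma measurable_sigmaOf [MeasurableSpace Ω] {x : ℕ → Ω → (Fin d → ℝ)} {S : Set ℕ} {k : ℕ}
    (hk : k ∈ S) : Measurable[sigmaOf x S] (x k) :=
  (comap_measurable (x k)).mono (le_iSup₂_of_le k hk le_rfl) le_rfl

lemma stronglyMeasurable_sigmaOf_eval [MeasurableSpace Ω] {x : ℕ → Ω → (Fin d → ℝ)} {S : Set ℕ}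
    {k : ℕ} (hk : k ∈ S) (a : Fin d) : StronglyMeasurable[sigmaOf x S] fun ω => x k ω a :=
  ((measurable_pi_apply a).comp (measurable_sigmaOf hk)).stronglyMeasurable

/-- The matrix extracting the block `k` of a stacked vector. -/
def blockProj (N d k : ℕ) : Matrix (Fin d) (Fin (N + 1) × Fin d) ℝ :=
  Matrix.of fun a p => if (p.1 : ℕ) = k ∧ p.2 = a then 1 else 0

lemma blockProj_mulVec_stacked [MeasurableSpace Ω] (x : ℕ → Ω → (Fin d → ℝ)) {N k : ℕ}
    (hk : k ≤ N) (ω : Ω) : (blockProj N d k).mulVec (stacked N x ω) = x k ω := by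
  ext a
  rw [Matrix.mulVec, dotProduct, Finset.sum_eq_single (⟨k, by omega⟩, a)]
  · simp [blockProj, stacked]
  · rintro ⟨i, b⟩ - hne
    have : ¬ ((i : ℕ) = k ∧ b = a) := by
      rintro ⟨rfl, rfl⟩
      exact hne rfl
    simp [blockProj, this]
  · simp

lemma mul_blockProj_apply_of_ne (A : Matrix (Fin d) (Fin d) ℝ) {N k : ℕ} (a : Fin d)
    {p : Fin (N + 1) × Fin d} (hp : (p.1 : ℕ) ≠ k) : (A * blockProj N d k) a p = 0 := by
  simp [Matrix.mul_apply, blockProj, hp]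

/-- Coefficients of the residual `x_k - A x_j - B x_c` as a linear map of the stacked vector. -/
def residualCoeff (N k j c : ℕ) (A B : Matrix (Fin d) (Fin d) ℝ) :
    Matrix (Fin d) (Fin (N + 1) × Fin d) ℝ :=
  blockProj N d k - (A * blockProj N d j + B * blockProj N d c)

lemma residualCoeff_mulVec_stacked [MeasurableSpace Ω] (x : ℕ → Ω → (Fin d → ℝ)) {N k j c : ℕ}
    (hk : k ≤ N) (hj : j ≤ N) (hc : c ≤ N) (A B : Matrix (Fin d) (Fin d) ℝ) (ω : Ω) :
    (residualCoeff N k j c A B).mulVec (stacked N x ω) =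
      x k ω - (A.mulVec (x j ω) + B.mulVec (x c ω)) := by
  simp only [residualCoeff, Matrix.sub_mulVec, Matrix.add_mulVec, ← Matrix.mulVec_mulVec,
    blockProj_mulVec_stacked x hk, blockProj_mulVec_stacked x hj, blockProj_mulVec_stacked x hc]

lemma residualCoeff_apply_of_ne {N k j c : ℕ} (A B : Matrix (Fin d) (Fin d) ℝ) (a : Fin d)
    {p : Fin (N + 1) × Fin d} (hj : (p.1 : ℕ) ≠ j) (hc : (p.1 : ℕ) ≠ c) :
    residualCoeff N k j c A B a p = blockProj N d k a p := by
  simp [residualCoeff, mul_blockProj_apply_of_ne A a hj, mul_blockProj_apply_of_ne B a hc]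

variable {mΩ : MeasurableSpace Ω} {P : Measure Ω} {N c : ℕ} {x : ℕ → Ω → (Fin d → ℝ)}

lemma measurable_stacked (hx : ∀ k, Measurable (x k)) : Measurable (stacked N x) :=
  measurable_pi_lambda _ fun p => (measurable_pi_apply p.2).comp (hx p.1)

lemma IsZMNG.hasGaussianLaw (h : IsZMNG N P x) (hx : ∀ k, Measurable (x k)) :
    HasGaussianLaw (stacked N x) P :=
  IsGaussianVec.hasGaussianLaw h.1 (measurable_stacked hx)

lemma IsZMNG.integral_stacked (h : IsZMNG N P x) (p : Fin (N + 1) × Fin d) :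
    ∫ ω, stacked N x ω p ∂P = 0 :=
  h.2.1 p.1 (by omega) p.2

lemma IsZMNG.memLp (h : IsZMNG N P x) (hx : ∀ k, Measurable (x k)) (p : Fin (N + 1) × Fin d) :
    MemLp (fun ω => stacked N x ω p) 2 P :=
  ((h.hasGaussianLaw hx).eval p).memLp_two

lemma IsZMNG.memLp_eval (h : IsZMNG N P x) (hx : ∀ k, Measurable (x k)) {k : ℕ} (hk : k ≤ N)
    (a : Fin d) : MemLp (fun ω => x k ω a) 2 P :=
  h.memLp hx (⟨k, by omega⟩, a)

lemma IsZMNG.memLp_dotProduct (h : IsZMNG N P x) (hx : ∀ k, Measurable (x k))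
    (w : Fin (N + 1) × Fin d → ℝ) : MemLp (fun ω => w ⬝ᵥ stacked N x ω) 2 P :=
  memLp_finsetSum _ fun p _ => (h.memLp hx p).const_mul (w p)

lemma IsZMNG.integral_dotProduct (h : IsZMNG N P x) (hx : ∀ k, Measurable (x k))
    [IsFiniteMeasure P] (w : Fin (N + 1) × Fin d → ℝ) :
    ∫ ω, w ⬝ᵥ stacked N x ω ∂P = 0 := by
  simp only [dotProduct]
  rw [integral_finsetSum _ fun p _ => ((h.memLp hx p).integrable one_le_two).const_mul (w p)]
  simp [integral_const_mul, h.integral_stacked]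

lemma IsZMNG.integral_dotProduct_mul (h : IsZMNG N P x) (hx : ∀ k, Measurable (x k))
    (w : Fin (N + 1) × Fin d → ℝ) {y : Ω → ℝ} (hy : MemLp y 2 P) :
    ∫ ω, (w ⬝ᵥ stacked N x ω) * y ω ∂P = ∑ p, w p * ∫ ω, stacked N x ω p * y ω ∂P := by
  simp only [dotProduct, Finset.sum_mul, mul_assoc]
  have hint : ∀ p, Integrable (fun ω => stacked N x ω p * y ω) P :=
    fun p => (h.memLp hx p).integrable_mul hy
  rw [integral_finsetSum _ fun p _ => (hint p).const_mul (w p)]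
  simp [integral_const_mul]

/-- The covariance matrix of the stacked vector. -/
noncomputable def stackedCov (N : ℕ) (P : Measure Ω) (x : ℕ → Ω → (Fin d → ℝ)) :
    Matrix (Fin (N + 1) × Fin d) (Fin (N + 1) × Fin d) ℝ :=
  Matrix.of fun p q => ∫ ω, x p.1 ω p.2 * x q.1 ω q.2 ∂P

lemma IsZMNG.integral_mulVec_mul_mulVec (h : IsZMNG N P x) (hx : ∀ k, Measurable (x k))
    (V W : Matrix (Fin d) (Fin (N + 1) × Fin d) ℝ) (a b : Fin d) :
    ∫ ω, V.mulVec (stacked N x ω) a * W.mulVec (stacked N x ω) b ∂P =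
      (V * stackedCov N P x * W.conjTranspose) a b := by
  simp only [Matrix.mulVec]
  rw [h.integral_dotProduct_mul hx _ (h.memLp_dotProduct hx (W b)), Matrix.mul_assoc,
    Matrix.mul_apply]
  refine Finset.sum_congr rfl fun p _ => ?_
  simp_rw [mul_comm (stacked N x _ p)]
  rw [h.integral_dotProduct_mul hx _ (h.memLp hx p), Matrix.mul_apply]
  congr 1
  refine Finset.sum_congr rfl fun q _ => ?_
  simp only [stackedCov, stacked, Matrix.of_apply, Matrix.conjTranspose_apply, star_trivial]
  rw [mul_comm]
  simp_rw [mul_comm (x q.1 _ q.2)]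

/-- Least-squares regression of `x_k` on `x_j` and `x_c`. -/
lemma IsZMNG.exists_residualCoeff (h : IsZMNG N P x) (hx : ∀ k, Measurable (x k)) {k j : ℕ}
    (hk : k ≤ N) (hj : j ≤ N) (hc : c ≤ N) :
    ∃ A B : Matrix (Fin d) (Fin d) ℝ, ∀ a, ∀ p : Fin (N + 1) × Fin d,
      ((p.1 : ℕ) = j ∨ (p.1 : ℕ) = c) →
      ∫ ω, (residualCoeff N k j c A B).mulVec (stacked N x ω) a * stacked N x ω p ∂P = 0 := by
  have hex := fun a => exists_linear_residual_orthogonal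
    (Sum.elim (fun b ω => x j ω b) (fun b ω => x c ω b))
    (by rintro (b | b); exacts [h.memLp_eval hx hj b, h.memLp_eval hx hc b])
    (h.memLp_eval hx hk a)
  choose w hw using hex
  refine ⟨Matrix.of fun a b => w a (Sum.inl b), Matrix.of fun a b => w a (Sum.inr b),
    fun a p hp => ?_⟩
  simp_rw [residualCoeff_mulVec_stacked x hk hj hc]
  rcases hp with hp | hp
  · simpa [Matrix.mulVec, dotProduct, stacked, hp] using hw a (Sum.inl p.2)
  · simpa [Matrix.mulVec, dotProduct, stacked, hp] using hw a (Sum.inr p.2)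

lemma IsCM.exists_residualCoeff [StandardBorelSpace Ω] [IsProbabilityMeasure P]
    {hx : ∀ k, Measurable (x k)} (hCM : IsCM N c P x hx) (h : IsZMNG N P x)
    (hc : c ≤ N) {k : ℕ} (hk : 1 ≤ k) (hkN : k ≤ N) (hkc : k ≠ c) :
    ∃ A B : Matrix (Fin d) (Fin d) ℝ, ∀ a, ∀ p : Fin (N + 1) × Fin d,
      ((p.1 : ℕ) < k ∨ (p.1 : ℕ) = c) →
      ∫ ω, (residualCoeff N k (k - 1) c A B).mulVec (stacked N x ω) a * stacked N x ω p ∂P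
        = 0 := by
  have hj : k - 1 ≤ N := by omega
  obtain ⟨A, B, hAB⟩ := h.exists_residualCoeff hx hkN hj hc
  refine ⟨A, B, fun a p hp => ?_⟩
  by_cases hp' : (p.1 : ℕ) = k - 1 ∨ (p.1 : ℕ) = c
  · exact hAB a p hp'
  rw [not_or] at hp'
  have hres := residualCoeff_mulVec_stacked x hkN hj hc A B
  let g : Ω → ℝ := fun ω => (A.mulVec (x (k - 1) ω) + B.mulVec (x c ω)) a
  have hfg : (fun ω => x k ω a) - g =
      fun ω => (residualCoeff N k (k - 1) c A B) a ⬝ᵥ stacked N x ω := by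
    ext ω
    exact (congrFun (hres ω) a).symm
  have hgm : StronglyMeasurable[sigmaOf x {k - 1, c}] g := by
    have hsum : ∀ (M : Matrix (Fin d) (Fin d) ℝ) {i}, i ∈ ({k - 1, c} : Set ℕ) →
        StronglyMeasurable[sigmaOf x {k - 1, c}] fun ω => M.mulVec (x i ω) a := fun M i hi =>
      Finset.stronglyMeasurable_fun_sum Finset.univ fun b _ =>
        (stronglyMeasurable_sigmaOf_eval hi b).const_mul (M a b)
    exact (hsum A (by simp)).add (hsum B (by simp))
  have hg2 : MemLp g 2 P :=
    (memLp_finsetSum Finset.univ fun b _ => (h.memLp_eval hx hj b).const_mul (A a b)).add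
      (memLp_finsetSum Finset.univ fun b _ => (h.memLp_eval hx hc b).const_mul (B a b))
  let π : Fin d ⊕ Fin d → Fin (N + 1) × Fin d :=
    Sum.elim (fun b => (⟨k - 1, by omega⟩, b)) (fun b => (⟨c, by omega⟩, b))
  let Z : Ω → Fin d ⊕ Fin d → ℝ := fun ω t => stacked N x ω (π t)
  have hindep := (h.hasGaussianLaw hx).indepFun_of_uncorrelated h.integral_stacked
    (residualCoeff N k (k - 1) c A B a) π fun t => hAB a (π t) (by rcases t with b | b <;> simp [π])
  have hle : sigmaOf x {k - 1, c} ≤ MeasurableSpace.comap Z inferInstance := by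
    have hm := comap_measurable (m := inferInstance) Z
    refine iSup₂_le fun i hi => Measurable.comap_le ?_
    rcases hi with rfl | hi
    · exact (show Measurable fun (z : Fin d ⊕ Fin d → ℝ) (b : Fin d) => z (Sum.inl b) by
        fun_prop).comp hm
    · rw [Set.mem_singleton_iff] at hi
      subst hi
      exact (show Measurable fun (z : Fin d ⊕ Fin d → ℝ) (b : Fin d) => z (Sum.inr b) by
        fun_prop).comp hm
  have key := integral_sub_mul_eq_zero_of_condIndep (sigmaOf_le hx _) (sigmaOf_le hx _)
    (sigmaOf_le hx _) (hCM (k - 1) hj)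
    (stronglyMeasurable_sigmaOf_eval (S := {i | k - 1 < i ∧ i ≤ N ∧ i ≠ c})
      ⟨by omega, hkN, hkc⟩ a) hgm
    (stronglyMeasurable_sigmaOf_eval (S := {i | i < k - 1 ∧ i ≠ c})
      (k := p.1) ⟨by omega, hp'.2⟩ p.2)
    (h.memLp_eval hx hkN a) hg2 (h.memLp hx p)
    (by rw [hfg]; exact indep_of_indep_of_le_right hindep hle)
    (by rw [hfg]; exact h.integral_dotProduct hx _)
  simp_rw [hres]
  exact key

/-- Coefficients of the noise `e_k` as a linear map of the stacked vector. -/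
lemma IsCM.exists_noiseCoeff [StandardBorelSpace Ω] [IsProbabilityMeasure P]
    {hx : ∀ k, Measurable (x k)} (hCM : IsCM N c P x hx) (h : IsZMNG N P x) (hN : 0 < N)
    (hc : c = 0 ∨ c = N) {k : ℕ} (hk : k ≤ N) :
    ∃ (A B : Matrix (Fin d) (Fin d) ℝ) (W : Matrix (Fin d) (Fin (N + 1) × Fin d) ℝ),
      (∀ a p, W a p ≠ 0 → (p.1 : ℕ) = k ∨ k ≠ c ∧ ((p.1 : ℕ) < k ∨ (p.1 : ℕ) = c)) ∧
      (∀ a p, (p.1 : ℕ) = k → W a p = if p.2 = a then 1 else 0) ∧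
      (k ≠ c → ∀ a, ∀ p : Fin (N + 1) × Fin d, ((p.1 : ℕ) < k ∨ (p.1 : ℕ) = c) →
        ∫ ω, W.mulVec (stacked N x ω) a * stacked N x ω p ∂P = 0) ∧
      (k = c → W = blockProj N d c) ∧
      (1 ≤ k → k ≠ c → W = residualCoeff N k (k - 1) c A B) ∧
      (k = 0 → c = N → W = residualCoeff N 0 N N A B) := by
  have hcN : c ≤ N := by omega
  have hdiag : ∀ a, ∀ p : Fin (N + 1) × Fin d, (p.1 : ℕ) = k →
      blockProj N d k a p = if p.2 = a then 1 else 0 := fun a p hp => by simp [blockProj, hp]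
  have hsupp : ∀ a, ∀ p : Fin (N + 1) × Fin d, (p.1 : ℕ) ≠ k → blockProj N d k a p = 0 :=
    fun a p hp => by simp [blockProj, hp]
  by_cases hkc : k = c
  · subst hkc
    refine ⟨0, 0, blockProj N d k, fun a p hp => ?_, hdiag, fun h => absurd rfl h, fun _ => rfl,
      fun _ h => absurd rfl h, fun _ _ => by omega⟩
    by_contra hne
    exact hp (hsupp a p fun h => hne (Or.inl h))
  rcases Nat.eq_zero_or_pos k with hk0 | hk1
  · obtain rfl : c = N := by omega
    subst hk0
    obtain ⟨A, B, hAB⟩ := h.exists_residualCoeff hx hk le_rfl le_rfl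
    refine ⟨A, B, residualCoeff c 0 c c A B, fun a p hp => ?_, fun a p hp => ?_,
      fun _ a p hp => hAB a p (by omega), fun h => absurd h hkc, fun _ => by omega,
      fun _ _ => rfl⟩
    · by_contra hne
      rw [residualCoeff_apply_of_ne _ _ _ (by omega) (by omega)] at hp
      exact hp (hsupp a p (by omega))
    · rw [residualCoeff_apply_of_ne _ _ _ (by omega) (by omega), hdiag a p hp]
  · obtain ⟨A, B, hAB⟩ := hCM.exists_residualCoeff h hcN hk1 hk hkc
    refine ⟨A, B, residualCoeff N k (k - 1) c A B, fun a p hp => ?_, fun a p hp => ?_,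
      fun _ => hAB, fun h => absurd h hkc, fun _ _ => rfl, fun _ => by omega⟩
    · by_contra hne
      rw [residualCoeff_apply_of_ne _ _ _ (by omega) (by omega)] at hp
      exact hp (hsupp a p (by omega))
    · rw [residualCoeff_apply_of_ne _ _ _ (by omega) (by omega), hdiag a p hp]

end

/-- every ZMNG `CM_c` sequence is governed by a `CM_c` model. -/
theorem stmt_5 [MeasurableSpace Ω] [StandardBorelSpace Ω]
    (N d c : ℕ) (hN : 2 ≤ N) (hd : 1 ≤ d) (hc : c = 0 ∨ c = N)
    (P : Measure Ω) [IsProbabilityMeasure P]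
    (x : ℕ → Ω → (Fin d → ℝ)) (hx : ∀ k, Measurable (x k))
    (hZMNG : IsZMNG N P x) (hCM : IsCM N c P x hx) :
    ∃ (A B : ℕ → Matrix (Fin d) (Fin d) ℝ) (G0N : Matrix (Fin d) (Fin d) ℝ)
      (e : ℕ → Ω → (Fin d → ℝ)) (G : ℕ → Matrix (Fin d) (Fin d) ℝ),
      GovernedBy N c P x A B G0N e G := by
  have hcN : c ≤ N := by omega
  have hex := fun (k : ℕ) (hk : k ≤ N) => hCM.exists_noiseCoeff hZMNG (by omega) hc hk
  choose! A B W hsupp hdiag horth hWc hW hW0 using hex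
  have hwhite : ∀ k ≤ N, ∀ j ≤ N, k ≠ j → (j ≠ c ∧ (k < j ∨ k = c)) → ∀ a b,
      ∫ ω, (W k).mulVec (stacked N x ω) a * (W j).mulVec (stacked N x ω) b ∂P = 0 := by
    intro k hk j hj hkj hpre a b
    refine (hZMNG.integral_dotProduct_mul hx _ (hZMNG.memLp_dotProduct hx (W j b))).trans ?_
    refine Finset.sum_eq_zero fun p _ => ?_
    by_cases hp : W k a p = 0
    · rw [hp, zero_mul]
    have hp' := hsupp k hk a p hp
    have h0 := horth j hj hpre.1 b p (by omega)
    simp_rw [mul_comm (stacked N x _ p)]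
    exact mul_eq_zero_of_right _ h0
  refine ⟨A, B, A 0 + B 0, fun k ω => (W k).mulVec (stacked N x ω),
    fun k => W k * stackedCov N P x * (W k).conjTranspose, ?_, ?_, ?_, ?_, ?_, ?_, ?_⟩
  · exact HasGaussianLaw.isGaussianVec_mulVec (hZMNG.hasGaussianLaw hx)
      (Matrix.of fun (p : Fin (N + 1) × Fin d) q => W p.1 p.2 q)
  · exact fun k _ a => hZMNG.integral_dotProduct hx (W k a)
  · intro k hk j hj hkj a b
    by_cases hpre : j ≠ c ∧ (k < j ∨ k = c)
    · exact hwhite k hk j hj hkj hpre a b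
    · simp_rw [mul_comm ((W k).mulVec _ a)]
      exact hwhite j hj k hk hkj.symm (by omega) b a
  · refine fun k hk => ⟨hZMNG.integral_mulVec_mul_mulVec hx (W k) (W k), ?_⟩
    refine Matrix.PosDef.mul_mul_conjTranspose_same hZMNG.2.2 fun u v huv => ?_
    ext b
    have hvec : ∀ u : Fin d → ℝ, Matrix.vecMul u (W k) (⟨k, by omega⟩, b) = u b := fun u => by
      simp [Matrix.vecMul, dotProduct, hdiag k hk _ (⟨k, by omega⟩, b) rfl]
    rw [← hvec u, ← hvec v]
    exact congrFun huv _
  · intro k hk1 hk hkc ω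
    simp only [hW k hk hk1 hkc, residualCoeff_mulVec_stacked x hk (by omega : k - 1 ≤ N) hcN]
    abel
  · rintro rfl
    ext1 ω
    simp only [hWc 0 hcN rfl, blockProj_mulVec_stacked x hcN]
  · rintro rfl
    refine ⟨?_, fun ω => ?_⟩
    · ext1 ω
      simp only [hWc c le_rfl rfl, blockProj_mulVec_stacked x le_rfl]
    · simp only [hW0 0 (Nat.zero_le _) rfl rfl, Matrix.add_mulVec,
        residualCoeff_mulVec_stacked x (Nat.zero_le _) le_rfl le_rfl]
      abel
end

section
/- Fix c ∈ {0, N}. Any sequence [x_k] governed by a CM_c model (with positive definite noise covariances G_0, …, G_N) is nonsingular: the covariance matrix of the stacked vector (x_0', …, x_N')' ∈ ℝ^{(N+1)d} is positive definite. -/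
open MeasureTheory ProbabilityTheory

variable {Ω : Type*}

section

open Matrix

/-- The `k`-th block of a stacked vector. -/
def block (N d : ℕ) (k : ℕ) : (Fin (N + 1) × Fin d → ℝ) →ₗ[ℝ] (Fin d → ℝ) where
  toFun y a := y (Fin.ofNat (N + 1) k, a)
  map_add' _ _ := rfl
  map_smul' _ _ := rfl

lemma block_stacked {d N k : ℕ} [MeasurableSpace Ω] (hk : k ≤ N) (x : ℕ → Ω → (Fin d → ℝ))
    (ω : Ω) : block N d k (stacked N x ω) = x k ω := by
  ext a
  simp [block, stacked, Nat.mod_eq_of_lt (Nat.lt_succ_of_le hk)]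

/-- The linear map recovering the stacked noise of a `CM_c` model from the stacked state. -/
def innovation {d : ℕ} (N c : ℕ) (A B : ℕ → Matrix (Fin d) (Fin d) ℝ)
    (G0N : Matrix (Fin d) (Fin d) ℝ) :
    (Fin (N + 1) × Fin d → ℝ) →ₗ[ℝ] (Fin (N + 1) × Fin d → ℝ) where
  toFun y p :=
    if (p.1 : ℕ) = c then block N d p.1 y p.2
    else if (p.1 : ℕ) = 0 then (block N d p.1 y - G0N *ᵥ block N d N y) p.2
    else (block N d p.1 y - A p.1 *ᵥ block N d (p.1 - 1) y - B p.1 *ᵥ block N d c y) p.2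
  map_add' y z := by
    ext p
    simp only [map_add, mulVec_add, Pi.add_apply, Pi.sub_apply]
    split_ifs <;> ring
  map_smul' r y := by
    ext p
    simp only [map_smul, mulVec_smul, Pi.smul_apply, Pi.sub_apply, smul_eq_mul, RingHom.id_apply]
    split_ifs <;> ring

lemma innovation_injective {d N c : ℕ} (hc : c = 0 ∨ c = N)
    (A B : ℕ → Matrix (Fin d) (Fin d) ℝ) (G0N : Matrix (Fin d) (Fin d) ℝ) :
    Function.Injective (innovation N c A B G0N) := by
  rw [← LinearMap.ker_eq_bot, LinearMap.ker_eq_bot']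
  intro y hy
  have hrow : ∀ k (hk : k ≤ N) a,
      (if k = c then block N d k y a
        else if k = 0 then (block N d k y - G0N *ᵥ block N d N y) a
        else (block N d k y - A k *ᵥ block N d (k - 1) y - B k *ᵥ block N d c y) a) = 0 :=
    fun k hk a => congrFun hy (⟨k, Nat.lt_succ_of_le hk⟩, a)
  have hcN : c ≤ N := by omega
  have hyc : block N d c y = 0 := by
    ext a
    simpa using hrow c hcN a
  have hy0 : block N d 0 y = 0 := by
    rcases hc with rfl | rfl
    · exact hyc
    · by_cases h0 : c = 0
      · simpa only [h0] using hyc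
      · ext a
        simpa [Ne.symm h0, hyc] using hrow 0 (Nat.zero_le _) a
  have hblock : ∀ k ≤ N, block N d k y = 0 := by
    intro k
    induction k with
    | zero => exact fun _ => hy0
    | succ k ih =>
      intro hk
      by_cases hkc : k + 1 = c
      · rw [hkc, hyc]
      · ext a
        simpa [hkc, hyc, ih (by omega)] using hrow (k + 1) hk a
  ext ⟨k, a⟩
  have := congrFun (hblock k (Nat.le_of_lt_succ k.2)) a
  simpa [block] using this

lemma GovernedBy.innovation_stacked {d N c : ℕ} [MeasurableSpace Ω] {P : Measure Ω}
    {x e : ℕ → Ω → (Fin d → ℝ)} {A B G : ℕ → Matrix (Fin d) (Fin d) ℝ}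
    {G0N : Matrix (Fin d) (Fin d) ℝ} (hc : c = 0 ∨ c = N)
    (h : GovernedBy N c P x A B G0N e G) (ω : Ω) :
    innovation N c A B G0N (stacked N x ω) = stacked N e ω := by
  obtain ⟨-, -, -, -, hdyn, h0, hN⟩ := h
  have hcN : c ≤ N := by omega
  ext ⟨k, a⟩
  have hk : (k : ℕ) ≤ N := Nat.le_of_lt_succ k.2
  simp only [innovation, LinearMap.coe_mk, AddHom.coe_mk, block_stacked hk,
    block_stacked hcN, block_stacked le_rfl, block_stacked ((Nat.sub_le _ 1).trans hk)]
  simp only [stacked]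
  split_ifs with hkc hk0
  · rcases hc with rfl | rfl
    · rw [hkc, h0 rfl]
    · rw [hkc, (hN rfl).1]
  · have hcN' : c = N := by omega
    rw [hk0, (hN hcN').2 ω]
    simp
  · rw [hdyn k (by omega) hk hkc ω]
    simp only [Pi.sub_apply, Pi.add_apply]
    ring

lemma IsGaussianVec.memLp_two {ι : Type*} [Fintype ι] [MeasurableSpace Ω]
    {X : Ω → (ι → ℝ)} {P : Measure Ω} (h : IsGaussianVec X P) (i : ι) :
    MemLp (fun ω => X ω i) 2 P := by
  classical
  obtain ⟨m, v, hmap⟩ := h (Pi.single i 1)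
  simp only [Pi.single_apply, ite_mul, one_mul, zero_mul, Finset.sum_ite_eq',
    Finset.mem_univ, if_true] at hmap
  have hmeas : AEMeasurable (fun ω => X ω i) P :=
    aemeasurable_of_map_neZero (by rw [hmap]; infer_instance)
  have hid : MemLp id 2 (P.map fun ω => X ω i) := by
    rw [hmap]
    exact memLp_id_gaussianReal 2
  exact hid.comp_of_map hmeas

/-- A zero-mean square-integrable random vector that an invertible linear map sends to one with
positive definite second-moment matrix has positive definite covariance. -/
lemma posDef_covariance_of_linearEquiv {ι : Type*} [Fintype ι] [DecidableEq ι]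
    [MeasurableSpace Ω] {P : Measure Ω} [IsProbabilityMeasure P] {X Y : Ω → (ι → ℝ)}
    (L : (ι → ℝ) ≃ₗ[ℝ] (ι → ℝ)) (hL : ∀ ω, L (X ω) = Y ω)
    (hY : ∀ i, MemLp (fun ω => Y ω i) 2 P) (hmean : ∀ i, ∫ ω, Y ω i ∂P = 0)
    (hpos : (Matrix.of fun i j => ∫ ω, Y ω i * Y ω j ∂P).PosDef) :
    (Matrix.of fun i j => ∫ ω, (X ω i - ∫ ω', X ω' i ∂P) *
      (X ω j - ∫ ω', X ω' j ∂P) ∂P).PosDef := by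
  set T := LinearMap.toMatrix' (L.symm : (ι → ℝ) →ₗ[ℝ] (ι → ℝ)) with hT
  have hX : ∀ ω i, X ω i = ∑ j, T i j * Y ω j := by
    intro ω i
    have : X ω = T *ᵥ Y ω := by
      rw [hT, LinearMap.toMatrix'_mulVec, ← hL ω]
      simp
    rw [this]
    rfl
  have hXmean : ∀ i, ∫ ω, X ω i ∂P = 0 := by
    intro i
    simp only [hX]
    rw [integral_finsetSum _ fun j _ => ((hY j).integrable one_le_two).const_mul _]
    simp [integral_const_mul, hmean]
  have hunit : IsUnit T := by
    have hinv : T * LinearMap.toMatrix' (L : (ι → ℝ) →ₗ[ℝ] (ι → ℝ)) = 1 := by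
      rw [hT, ← LinearMap.toMatrix'_comp]
      simp
    exact (Matrix.isUnit_iff_isUnit_det _).2 (Matrix.isUnit_det_of_right_inverse hinv)
  have key := (Matrix.IsUnit.posDef_star_right_conjugate_iff hunit).2 hpos
  convert key using 1
  ext i j
  have hint : ∀ k l, Integrable (fun ω => Y ω k * Y ω l) P :=
    fun k l => (hY k).integrable_mul (hY l)
  have hexp : ∀ ω, X ω i * X ω j = ∑ l, ∑ k, T i k * T j l * (Y ω k * Y ω l) := by
    intro ω
    rw [hX, hX, Finset.sum_mul_sum, Finset.sum_comm]
    exact Finset.sum_congr rfl fun l _ => Finset.sum_congr rfl fun k _ => by ring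
  simp only [Matrix.of_apply, hXmean, sub_zero, hexp]
  rw [integral_finsetSum _ fun l _ => integrable_finsetSum _ fun k _ => (hint k l).const_mul _]
  simp only [Matrix.mul_apply, Matrix.star_apply, Finset.sum_mul, Matrix.of_apply, star_trivial]
  refine Finset.sum_congr rfl fun l _ => ?_
  rw [integral_finsetSum _ fun k _ => (hint k l).const_mul _]
  refine Finset.sum_congr rfl fun k _ => ?_
  rw [integral_const_mul]
  ring

/-- A block diagonal real matrix with positive definite blocks is positive definite. -/
lemma posDef_of_blocks {κ ι : Type*} [Fintype κ] [Fintype ι] [DecidableEq κ]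
    {G : κ → Matrix ι ι ℝ} (hG : ∀ k, (G k).PosDef) :
    (Matrix.of fun p q : κ × ι => if p.1 = q.1 then G p.1 p.2 q.2 else 0).PosDef := by
  refine .of_dotProduct_mulVec_pos ?_ fun v hv => ?_
  · ext ⟨k, a⟩ ⟨l, b⟩
    by_cases hkl : k = l
    · subst hkl
      simpa using (hG k).isHermitian.apply a b
    · simp [hkl, Ne.symm hkl]
  · have hsum : star v ⬝ᵥ ((Matrix.of fun p q : κ × ι =>
        if p.1 = q.1 then G p.1 p.2 q.2 else 0) *ᵥ v) =
        ∑ k, star (fun a => v (k, a)) ⬝ᵥ (G k *ᵥ fun a => v (k, a)) := by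
      simp only [dotProduct, mulVec, Fintype.sum_prod_type, Matrix.of_apply, ite_mul, zero_mul,
        Pi.star_apply]
      refine Finset.sum_congr rfl fun k _ => Finset.sum_congr rfl fun a _ => ?_
      congr 1
      rw [Finset.sum_eq_single k]
      · simp
      · intro l _ hl
        simp [Ne.symm hl]
      · simp
    rw [hsum]
    obtain ⟨⟨k, a⟩, hka⟩ := Function.ne_iff.1 hv
    refine Finset.sum_pos' (fun l _ => (hG l).posSemidef.dotProduct_mulVec_nonneg _)
      ⟨k, Finset.mem_univ k, (hG k).dotProduct_mulVec_pos fun h => hka (congrFun h a)⟩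

end

/-- any sequence governed by a `CM_c` model (with positive definite noise
covariances) is nonsingular: the covariance matrix of the stacked vector is positive
definite. -/
theorem stmt_7 [MeasurableSpace Ω]
    (N d c : ℕ) (hN : 2 ≤ N) (hd : 1 ≤ d) (hc : c = 0 ∨ c = N)
    (P : Measure Ω) [IsProbabilityMeasure P]
    (x e : ℕ → Ω → (Fin d → ℝ))
    (A B : ℕ → Matrix (Fin d) (Fin d) ℝ) (G0N : Matrix (Fin d) (Fin d) ℝ)
    (G : ℕ → Matrix (Fin d) (Fin d) ℝ)
    (h : GovernedBy N c P x A B G0N e G) :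
    (Matrix.of fun p q : Fin (N + 1) × Fin d =>
      ∫ ω, (x p.1 ω p.2 - ∫ ω', x p.1 ω' p.2 ∂P) *
        (x q.1 ω q.2 - ∫ ω', x q.1 ω' q.2 ∂P) ∂P).PosDef := by
  obtain ⟨hgauss, hmean, hwhite, hcov, -⟩ := id h
  refine posDef_covariance_of_linearEquiv (X := stacked N x) (Y := stacked N e)
    (LinearEquiv.ofInjectiveEndo _ (innovation_injective hc A B G0N))
    (fun ω => h.innovation_stacked hc ω) hgauss.memLp_two
    (fun p => hmean p.1 (Nat.le_of_lt_succ p.1.2) p.2) ?_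
  convert posDef_of_blocks (κ := Fin (N + 1)) (G := fun k => G k)
    (fun k => (hcov k (Nat.le_of_lt_succ k.2)).2) using 1
  ext ⟨k, a⟩ ⟨l, b⟩
  have hk := Nat.le_of_lt_succ k.2
  have hl := Nat.le_of_lt_succ l.2
  simp only [Matrix.of_apply, stacked]
  split_ifs with hkl
  · subst hkl
    exact (hcov k hk).1 a b
  · exact hwhite k hk l hl (fun h => hkl (Fin.ext h)) a b
end
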